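/- Let Y and Z be independent random variables with Y distributed as Exp(1) and Z distributed as Gamma(K,1) (shape K, rate 1), where K ≥ 1 is an integer, and let a > 0 and b ≥ 0 be constants. Then the random variable S = Y/(a + bZ) has cumulative distribution function P(S ≤ x) = 1 − e^{−a x}/(b x + 1)^K for every x ≥ 0. -/

import Mathlib

open MeasureTheory ProbabilityTheory

/-- The tail of the exponential distribution. -/
lemma expMeasure_Ioi {r t : ℝ} (hr : 0 < r) (ht : 0 ≤ t) :
    expMeasure r (Set.Ioi t) = ENNReal.ofReal (Real.exp (-(r * t))) := by
  have := isProbabilityMeasure_expMeasure hr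
  have hIic : expMeasure r (Set.Iic t) = ENNReal.ofReal (1 - Real.exp (-(r * t))) := by
    rw [← ofReal_cdf, cdf_expMeasure_eq hr, if_pos ht]
  have hle : Real.exp (-(r * t)) ≤ 1 := Real.exp_le_one_iff.2 (by nlinarith)
  rw [← Set.compl_Iic, prob_compl_eq_one_sub measurableSet_Iic, hIic, ← ENNReal.ofReal_one,
    ← ENNReal.ofReal_sub _ (by linarith), sub_sub_cancel]

lemma ae_nonneg_gammaMeasure (k r : ℝ) : ∀ᵐ z ∂gammaMeasure k r, 0 ≤ z := by
  have h : {z : ℝ | ¬ 0 ≤ z} = Set.Iio 0 := by ext z; simp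
  rw [ae_iff, h, gammaMeasure, withDensity_apply _ measurableSet_Iio]
  exact lintegral_gammaPDF_of_nonpos le_rfl

/-- Exponential tilting of the gamma density. -/
lemma gammaPDF_mul_exp {k r s : ℝ} (hr : 0 < r) (hs : 0 ≤ s) (z : ℝ) :
    gammaPDF k r z * ENNReal.ofReal (Real.exp (-(s * z))) =
      ENNReal.ofReal ((r / (r + s)) ^ k) * gammaPDF k (r + s) z := by
  rcases lt_or_ge z 0 with hz | hz
  · simp [gammaPDF_of_neg hz]
  · have hrs : 0 < r + s := by linarith
    have hpow : (r + s) ^ k ≠ 0 := (Real.rpow_pos_of_pos hrs k).ne'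
    rw [gammaPDF_of_nonneg hz, gammaPDF_of_nonneg hz,
      ← ENNReal.ofReal_mul' (Real.exp_pos _).le, ← ENNReal.ofReal_mul (by positivity),
      Real.div_rpow hr.le hrs.le, mul_assoc _ (Real.exp _), ← Real.exp_add]
    congr 1
    rw [show -(r * z) + -(s * z) = -((r + s) * z) by ring]
    field_simp

/-- The Laplace transform of the gamma distribution. -/
lemma lintegral_exp_neg_mul_gammaMeasure {k r s : ℝ} (hk : 0 < k) (hr : 0 < r) (hs : 0 ≤ s) :
    ∫⁻ z, ENNReal.ofReal (Real.exp (-(s * z))) ∂gammaMeasure k r =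
      ENNReal.ofReal ((r / (r + s)) ^ k) := by
  have hmeas (q : ℝ) : Measurable (gammaPDF k q) := (measurable_gammaPDFReal k q).ennreal_ofReal
  rw [gammaMeasure, lintegral_withDensity_eq_lintegral_mul _ (hmeas r) (by fun_prop)]
  simp only [Pi.mul_apply, gammaPDF_mul_exp hr hs]
  rw [lintegral_const_mul _ (hmeas _), lintegral_gammaPDF_eq_one hk (by linarith), mul_one]

/-- If `Y ~ Exp(1)` and `Z ~ Gamma(K,1)` are independent, `a > 0`, `b ≥ 0`,
then `S = Y/(a + bZ)` has CDF `P(S ≤ x) = 1 − e^{−ax}/(bx+1)^K` for every `x ≥ 0`. -/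
theorem cdf_of_exp_over_affine_gamma
    {Ω : Type*} [MeasureSpace Ω] [IsProbabilityMeasure (ℙ : Measure Ω)]
    (K : ℕ) (hK : 1 ≤ K) (a b : ℝ) (ha : 0 < a) (hb : 0 ≤ b)
    (Y Z : Ω → ℝ)
    (hYZ : IndepFun Y Z ℙ)
    (hY : Measure.map Y ℙ = expMeasure 1)
    (hZ : Measure.map Z ℙ = gammaMeasure (K : ℝ) 1)
    (x : ℝ) (hx : 0 ≤ x) :
    ℙ {ω | Y ω / (a + b * Z ω) ≤ x} =
      ENNReal.ofReal (1 - Real.exp (-(a * x)) / (b * x + 1) ^ K) := by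
  have hK0 : (0 : ℝ) < K := by exact_mod_cast hK
  have := isProbabilityMeasure_expMeasure one_pos
  have := isProbabilityMeasure_gammaMeasure hK0 one_pos
  have hYm : AEMeasurable Y ℙ :=
    AEMeasurable.of_map_ne_zero (hY ▸ IsProbabilityMeasure.ne_zero _)
  have hZm : AEMeasurable Z ℙ :=
    AEMeasurable.of_map_ne_zero (hZ ▸ IsProbabilityMeasure.ne_zero _)
  have hlaw : Measure.map (fun ω ↦ (Z ω, Y ω)) ℙ =
      (gammaMeasure (K : ℝ) 1).prod (expMeasure 1) := by
    rw [(indepFun_iff_map_prod_eq_prod_map_map hZm hYm).1 hYZ.symm, hY, hZ]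
  let A : Set (ℝ × ℝ) := {p | p.2 / (a + b * p.1) ≤ x}
  have hA : MeasurableSet A := measurableSet_le (by fun_prop) measurable_const
  have hcompl : (gammaMeasure (K : ℝ) 1).prod (expMeasure 1) Aᶜ =
      ENNReal.ofReal (Real.exp (-(a * x)) / (b * x + 1) ^ K) := by
    rw [Measure.prod_apply hA.compl]
    calc ∫⁻ z, expMeasure 1 (Prod.mk z ⁻¹' Aᶜ) ∂gammaMeasure (K : ℝ) 1
        = ∫⁻ z, ENNReal.ofReal (Real.exp (-(a * x))) *
            ENNReal.ofReal (Real.exp (-(b * x * z))) ∂gammaMeasure (K : ℝ) 1 := by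
          refine lintegral_congr_ae ?_
          filter_upwards [ae_nonneg_gammaMeasure (K : ℝ) 1] with z hz
          have hpos : 0 < a + b * z := by positivity
          have hset : Prod.mk z ⁻¹' Aᶜ = Set.Ioi (x * (a + b * z)) := by
            ext y
            simp [A, lt_div_iff₀ hpos]
          rw [hset, expMeasure_Ioi one_pos (by positivity),
            ← ENNReal.ofReal_mul (Real.exp_pos _).le, ← Real.exp_add]
          ring_nf
      _ = ENNReal.ofReal (Real.exp (-(a * x)) / (b * x + 1) ^ K) := by
          rw [lintegral_const_mul _ (by fun_prop),
            lintegral_exp_neg_mul_gammaMeasure hK0 one_pos (by positivity),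
            ← ENNReal.ofReal_mul (Real.exp_pos _).le, Real.rpow_natCast, div_pow, one_pow,
            mul_one_div, add_comm 1]
  calc ℙ {ω | Y ω / (a + b * Z ω) ≤ x}
      = (gammaMeasure (K : ℝ) 1).prod (expMeasure 1) A := by
        rw [← hlaw, Measure.map_apply_of_aemeasurable (hZm.prodMk hYm) hA]
        rfl
    _ = 1 - ENNReal.ofReal (Real.exp (-(a * x)) / (b * x + 1) ^ K) := by
        rw [← hcompl, ← prob_compl_eq_one_sub hA.compl, compl_compl]
    _ = ENNReal.ofReal (1 - Real.exp (-(a * x)) / (b * x + 1) ^ K) := by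
        rw [ENNReal.ofReal_sub _ (by positivity), ENNReal.ofReal_one]
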